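/- A nonstandard short recursively saturated model M of PA is not finitely generated: there is no element a ∈ M such that every element of M is first-order definable from a. -/

import Mathlib

open FirstOrder FirstOrder.Language

/-- The language of arithmetic: constants 0 and 1, binary functions + and ·, and a
binary relation ≤. -/
def Larith : FirstOrder.Language where
  Functions := fun n =>
    match n with
    | 0 => Fin 2
    | 2 => Fin 2
    | _ => Empty
  Relations := fun n =>
    match n with
    | 2 => Unit
    | _ => Empty

section
variable {M : Type} [Larith.Structure M]

/-- The interpretation of 0. -/
def zeroM (M : Type) [Larith.Structure M] : M :=
  Structure.funMap (L := Larith) (M := M) (n := 0) (0 : Fin 2) ![]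

/-- The interpretation of 1. -/
def oneM (M : Type) [Larith.Structure M] : M :=
  Structure.funMap (L := Larith) (M := M) (n := 0) (1 : Fin 2) ![]

/-- The interpretation of +. -/
def addM (x y : M) : M :=
  Structure.funMap (L := Larith) (M := M) (n := 2) (0 : Fin 2) ![x, y]

/-- The interpretation of ·. -/
def mulM (x y : M) : M :=
  Structure.funMap (L := Larith) (M := M) (n := 2) (1 : Fin 2) ![x, y]

/-- The interpretation of ≤. -/
def leM (x y : M) : Prop :=
  Structure.RelMap (L := Larith) (M := M) (n := 2) (Unit.unit) ![x, y]

/-- A structure in the language of arithmetic is a model of Peano Arithmetic: it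
satisfies the basic axioms for 0, 1, +, ·, ≤ and the full first-order induction
scheme (with parameters). -/
structure IsPAModel (M : Type) [Larith.Structure M] : Prop where
  succ_ne_zero : ∀ x : M, addM x (oneM M) ≠ zeroM M
  succ_inj : ∀ x y : M, addM x (oneM M) = addM y (oneM M) → x = y
  add_zero' : ∀ x : M, addM x (zeroM M) = x
  add_succ : ∀ x y : M, addM x (addM y (oneM M)) = addM (addM x y) (oneM M)
  mul_zero' : ∀ x : M, mulM x (zeroM M) = zeroM M
  mul_succ : ∀ x y : M, mulM x (addM y (oneM M)) = addM (mulM x y) x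
  le_iff : ∀ x y : M, leM x y ↔ ∃ z : M, addM x z = y
  induction : ∀ (n : ℕ) (φ : Larith.Formula (Fin (n + 1))) (v : Fin n → M),
    φ.Realize (Fin.snoc v (zeroM M)) →
    (∀ x : M, φ.Realize (Fin.snoc v x) → φ.Realize (Fin.snoc v (addM x (oneM M)))) →
    ∀ x : M, φ.Realize (Fin.snoc v x)

/-- `b` is first-order definable from `a` in `M`. -/
def DefinableFrom (a b : M) : Prop :=
  ∃ φ : Larith.Formula (Fin 2), ∀ y : M, φ.Realize ![a, y] ↔ y = b

end

instance LarithFunEnc : ∀ n, Encodable (Larith.Functions n)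
  | 0 => (inferInstance : Encodable (Fin 2))
  | 1 => (inferInstance : Encodable Empty)
  | 2 => (inferInstance : Encodable (Fin 2))
  | (_ + 3) => (inferInstance : Encodable Empty)

instance LarithRelEnc : ∀ n, Encodable (Larith.Relations n)
  | 0 => (inferInstance : Encodable Empty)
  | 1 => (inferInstance : Encodable Empty)
  | 2 => (inferInstance : Encodable Unit)
  | (_ + 3) => (inferInstance : Encodable Empty)

/-- The Gödel code of a formula of arithmetic, via Mathlib's canonical list encoding of
bounded formulas. -/
def formulaCode {m : ℕ} (φ : Larith.Formula (Fin m)) : ℕ :=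
  Encodable.encode (BoundedFormula.listEncode φ)

/-- A set of formulas is recursive if the corresponding set of Gödel codes is
computable. -/
def IsRecursiveSet {m : ℕ} (S : Set (Larith.Formula (Fin m))) : Prop :=
  ComputablePred (fun n : ℕ => ∃ φ ∈ S, formulaCode φ = n)

/-- The formula expressing that the last variable is strictly less than variable `i`. -/
def ltFormula (k : ℕ) (i : Fin (k + 1)) : Larith.Formula (Fin (k + 1)) :=
  (Relations.boundedFormula₂ (Unit.unit : Larith.Relations 2)
      (Term.var (Sum.inl (Fin.last k))) (Term.var (Sum.inl i))) ⊓
    (BoundedFormula.not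
      (Term.bdEqual (Term.var (Sum.inl (Fin.last k))) (Term.var (Sum.inl i))))

/-- `M` is short recursively saturated: every recursive bounded type with parameters
from `M` (a recursive set of formulas containing "x < c" for some parameter c, all of
whose finite subsets are satisfiable in M) is realized in M. -/
def ShortRecSat (M : Type) [Larith.Structure M] : Prop :=
  ∀ (k : ℕ) (S : Set (Larith.Formula (Fin (k + 1)))), IsRecursiveSet S →
    (∃ i : Fin k, ltFormula k i.castSucc ∈ S) →
    ∀ v : Fin k → M,
      (∀ T : Finset (Larith.Formula (Fin (k + 1))), ↑T ⊆ S →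
        ∃ x : M, ∀ φ ∈ T, Formula.Realize φ (Fin.snoc v x)) →
      ∃ x : M, ∀ φ ∈ S, Formula.Realize φ (Fin.snoc v x)

/-- The numeral n in a structure for the language of arithmetic. -/
def numeral (M : Type) [Larith.Structure M] : ℕ → M
  | 0 => zeroM M
  | n + 1 => addM (numeral M n) (oneM M)

namespace ShortRecSatProof

/-! ### An enumeration of terms and formulas -/

/-- Terms and formulas in one free variable and `n` bound variables. -/
abbrev Expr (n : ℕ) : Type :=
  Larith.Term (Fin 1 ⊕ Fin n) ⊕ Larith.BoundedFormula (Fin 1) n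

/-- The addition symbol. -/
abbrev addSymb : Larith.Functions 2 := (0 : Fin 2)

/-- The multiplication symbol. -/
abbrev mulSymb : Larith.Functions 2 := (1 : Fin 2)

/-- The symbol for the constant 0. -/
abbrev zeroSymb : Larith.Functions 0 := (0 : Fin 2)

/-- The symbol for the constant 1. -/
abbrev oneSymb : Larith.Functions 0 := (1 : Fin 2)

/-- The order symbol. -/
abbrev leSymb : Larith.Relations 2 := Unit.unit

/-- The constant 0 as a term. -/
abbrev zeroTerm {α : Type} : Larith.Term α := .func zeroSymb ![]

/-- The constant 1 as a term. -/
abbrev oneTerm {α : Type} : Larith.Term α := .func oneSymb ![]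

/-- The binary formation rules, with `⊥` as the default value. -/
def merge {n : ℕ} : ℕ → Expr n → Expr n → Expr n
  | 0, .inl s, .inl t => .inl (.func addSymb ![s, t])
  | 1, .inl s, .inl t => .inl (.func mulSymb ![s, t])
  | 2, .inl s, .inl t => .inr (.equal s t)
  | 3, .inl s, .inl t => .inr (.rel leSymb ![s, t])
  | 4, .inr φ, .inr ψ => .inr (.imp φ ψ)
  | _, _, _ => .inr .falsum

/-- All formation rules; the rule `op` uses either the numbers `i`, `j` or the previously
formed expressions. -/
def node (op i j : ℕ) (A B : Σ n, Expr n) : Σ n, Expr n :=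
  match op with
  | 0 => ⟨i, .inl (.var (.inl 0))⟩
  | 1 => ⟨i + j + 1, .inl (.var (.inr ⟨j, by omega⟩))⟩
  | 2 => ⟨i, .inl zeroTerm⟩
  | 3 => ⟨i, .inl oneTerm⟩
  | 4 => ⟨i, .inr .falsum⟩
  | 5 =>
    match A with
    | ⟨n + 1, .inr φ⟩ => ⟨n, .inr φ.all⟩
    | _ => ⟨0, .inr .falsum⟩
  | op + 6 => if h : B.1 = A.1 then ⟨A.1, merge op A.2 (h ▸ B.2)⟩ else ⟨0, .inr .falsum⟩

/-- An enumeration of all expressions. -/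
def enum : ℕ → Σ n, Expr n
  | 0 => ⟨0, .inr .falsum⟩
  | m + 1 =>
    node m.unpair.1 m.unpair.2.unpair.1 m.unpair.2.unpair.2
      (enum m.unpair.2.unpair.1) (enum m.unpair.2.unpair.2)
decreasing_by
  · exact Nat.lt_succ_of_le ((Nat.unpair_left_le _).trans (Nat.unpair_right_le _))
  · exact Nat.lt_succ_of_le ((Nat.unpair_right_le _).trans (Nat.unpair_right_le _))

theorem enum_pair (op i j : ℕ) :
    enum (Nat.pair op (Nat.pair i j) + 1) = node op i j (enum i) (enum j) := by
  rw [enum]; simp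

theorem exists_enum_merge {n : ℕ} (op : ℕ) {e₁ e₂ : Expr n} (h₁ : ∃ m, enum m = ⟨n, e₁⟩)
    (h₂ : ∃ m, enum m = ⟨n, e₂⟩) : ∃ m, enum m = ⟨n, merge op e₁ e₂⟩ := by
  obtain ⟨i, hi⟩ := h₁
  obtain ⟨j, hj⟩ := h₂
  exact ⟨_, (enum_pair (op + 6) i j).trans (by rw [hi, hj]; exact dif_pos rfl)⟩

theorem exists_enum_term {n : ℕ} (t : Larith.Term (Fin 1 ⊕ Fin n)) :
    ∃ m, enum m = ⟨n, .inl t⟩ := by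
  induction t with
  | var a =>
    rcases a with a | ⟨j, hj⟩
    · obtain rfl : a = 0 := Subsingleton.elim _ _
      exact ⟨_, enum_pair 0 n 0⟩
    · obtain ⟨i, rfl⟩ : ∃ i, n = i + j + 1 := ⟨n - j - 1, by omega⟩
      exact ⟨_, enum_pair 1 i j⟩
  | @func l f ts ih =>
    match l, f, ts, ih with
    | 0, (0 : Fin 2), ts, _ =>
      obtain rfl : ts = ![] := Subsingleton.elim _ _
      exact ⟨_, enum_pair 2 n 0⟩
    | 0, (1 : Fin 2), ts, _ =>
      obtain rfl : ts = ![] := Subsingleton.elim _ _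
      exact ⟨_, enum_pair 3 n 0⟩
    | 1, f, _, _ => exact Empty.elim f
    | 2, (0 : Fin 2), ts, ih =>
      have h := exists_enum_merge 0 (ih 0) (ih 1)
      rwa [merge, show ![ts 0, ts 1] = ts by ext i; fin_cases i <;> rfl] at h
    | 2, (1 : Fin 2), ts, ih =>
      have h := exists_enum_merge 1 (ih 0) (ih 1)
      rwa [merge, show ![ts 0, ts 1] = ts by ext i; fin_cases i <;> rfl] at h
    | _ + 3, f, _, _ => exact Empty.elim f

theorem exists_enum_formula {n : ℕ} (φ : Larith.BoundedFormula (Fin 1) n) :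
    ∃ m, enum m = ⟨n, .inr φ⟩ := by
  induction φ with
  | @falsum n => exact ⟨_, enum_pair 4 n 0⟩
  | equal s t => exact exists_enum_merge 2 (exists_enum_term s) (exists_enum_term t)
  | @rel n l R ts =>
    match l, R, ts with
    | 0, R, _ => exact Empty.elim R
    | 1, R, _ => exact Empty.elim R
    | 2, Unit.unit, ts =>
      have h := exists_enum_merge 3 (exists_enum_term (ts 0)) (exists_enum_term (ts 1))
      rwa [merge, show ![ts 0, ts 1] = ts by ext i; fin_cases i <;> rfl] at h
    | _ + 3, R, _ => exact Empty.elim R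
  | imp _ _ ih₁ ih₂ => exact exists_enum_merge 4 ih₁ ih₂
  | all _ ih =>
    obtain ⟨i, hi⟩ := ih
    exact ⟨_, (enum_pair 5 i 0).trans (by simp [node, hi])⟩

/-! ### Codes of the enumerated expressions -/

/-- Renames the free variable of a term to the first of three variables. -/
abbrev liftTerm (n : ℕ) (t : Larith.Term (Fin 1 ⊕ Fin n)) : Larith.Term (Fin 3 ⊕ Fin n) :=
  t.relabel (Sum.map (fun _ => 0) id)

/-- Renames the free variable of a formula to the first of three variables. -/
abbrev liftFormula {n : ℕ} (φ : Larith.BoundedFormula (Fin 1) n) :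
    Larith.BoundedFormula (Fin 3) n :=
  φ.mapTermRel liftTerm (fun _ => id) (fun _ => id)

/-- The sequence of codes of the symbols of a formula. -/
def symbols {n : ℕ} (φ : Larith.BoundedFormula (Fin 3) n) : List ℕ :=
  φ.listEncode.map Encodable.encode

/-- The sequence of codes of the symbols of a term. -/
def termSymbols {n : ℕ} (t : Larith.Term (Fin 3 ⊕ Fin n)) : List ℕ :=
  t.listEncode.map Encodable.encode

theorem encode_map_encode {α : Type*} [Encodable α] (l : List α) :
    Encodable.encode (l.map Encodable.encode) = Encodable.encode l := by
  induction l with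
  | nil => rfl
  | cons a l ih => simp [Encodable.encode_list_cons, ih]

theorem formulaCode_eq (φ : Larith.Formula (Fin 3)) :
    formulaCode φ = Encodable.encode (symbols φ) :=
  (encode_map_encode _).symm

theorem encode_term {n : ℕ} (t : Larith.Term (Fin 3 ⊕ Fin n)) :
    Encodable.encode t = Encodable.encode (termSymbols t) :=
  (encode_map_encode _).symm

/-- The code of the logical symbol with number `k`. -/
def logicSymbol (k : ℕ) : ℕ := 2 * (2 * k + 1) + 1

/-- The code of a term with code list `l`, as a symbol of a formula. -/
def termSymbol (n : ℕ) (l : List ℕ) : ℕ := 2 * Nat.pair n (Encodable.encode l)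

theorem encode_inl_term {n : ℕ} (t : Larith.Term (Fin 3 ⊕ Fin n)) : Encodable.encode (.inl ⟨n, t⟩ :
    (Σ k, Larith.Term (Fin 3 ⊕ Fin k)) ⊕ ((Σ n, Larith.Relations n) ⊕ ℕ)) =
      termSymbol n (termSymbols t) := by
  rw [Encodable.encode_inl, Encodable.encode_sigma_val, encode_term]; rfl

theorem symbols_falsum {n : ℕ} :
    symbols (.falsum : Larith.BoundedFormula (Fin 3) n) = [logicSymbol (n + 2)] := rfl

theorem symbols_equal {n : ℕ} (s t : Larith.Term (Fin 3 ⊕ Fin n)) :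
    symbols (.equal s t) = [termSymbol n (termSymbols s), termSymbol n (termSymbols t)] := by
  simp [symbols, BoundedFormula.listEncode, encode_term, termSymbol]

theorem symbols_le {n : ℕ} (ts : Fin 2 → Larith.Term (Fin 3 ⊕ Fin n)) :
    symbols (.rel leSymb ts) = [2 * (2 * Nat.pair 2 0) + 1, logicSymbol n,
      termSymbol n (termSymbols (ts 0)), termSymbol n (termSymbols (ts 1))] := by
  simp only [symbols, BoundedFormula.listEncode, List.map_append, List.map_cons, List.map_nil,
    List.finRange_succ, List.finRange_zero, encode_inl_term]
  rfl

theorem symbols_imp {n : ℕ} (φ ψ : Larith.BoundedFormula (Fin 3) n) :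
    symbols (.imp φ ψ) = logicSymbol 0 :: (symbols φ ++ symbols ψ) := by
  simp [symbols, BoundedFormula.listEncode, logicSymbol]

theorem symbols_all {n : ℕ} (φ : Larith.BoundedFormula (Fin 3) (n + 1)) :
    symbols (.all φ) = logicSymbol 1 :: symbols φ := by
  simp [symbols, BoundedFormula.listEncode, logicSymbol]

theorem termSymbols_func₂ {n : ℕ} (f : Larith.Functions 2) (ts : Fin 2 → Larith.Term (Fin 3 ⊕ Fin n)) :
    termSymbols (.func f ts) =
      (2 * Nat.pair 2 (Encodable.encode f) + 1) :: (termSymbols (ts 0) ++ termSymbols (ts 1)) := by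
  simp only [termSymbols, Term.listEncode, List.map_cons, List.finRange_succ, List.finRange_zero,
    List.flatMap_cons, List.map_append, List.map_nil, List.flatMap_nil, List.append_nil]
  rfl

/-- The code of an expression: whether it is a formula, and the codes of its symbols. -/
def exprCode {n : ℕ} : Expr n → Bool × List ℕ
  | .inl t => (false, termSymbols (liftTerm n t))
  | .inr φ => (true, symbols (liftFormula φ))

/-- The number of bound variables and the code of an expression. -/
def code (A : Σ n, Expr n) : ℕ × Bool × List ℕ := (A.1, exprCode A.2)

/-- The operation on codes corresponding to `merge`. -/
def mergeCode (op n : ℕ) (a b : Bool × List ℕ) : Bool × List ℕ :=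
  if a.1 = false ∧ b.1 = false ∧ op = 0 then (false, (2 * Nat.pair 2 0 + 1) :: (a.2 ++ b.2)) else
  if a.1 = false ∧ b.1 = false ∧ op = 1 then (false, (2 * Nat.pair 2 1 + 1) :: (a.2 ++ b.2)) else
  if a.1 = false ∧ b.1 = false ∧ op = 2 then (true, [termSymbol n a.2, termSymbol n b.2]) else
  if a.1 = false ∧ b.1 = false ∧ op = 3 then
    (true, [2 * (2 * Nat.pair 2 0) + 1, logicSymbol n, termSymbol n a.2, termSymbol n b.2]) else
  if a.1 = true ∧ b.1 = true ∧ op = 4 then (true, logicSymbol 0 :: (a.2 ++ b.2)) else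
  (true, [logicSymbol (n + 2)])

theorem exprCode_merge {n : ℕ} (op : ℕ) (e₁ e₂ : Expr n) :
    exprCode (merge op e₁ e₂) = mergeCode op n (exprCode e₁) (exprCode e₂) := by
  rcases e₁ with s | φ <;> rcases e₂ with t | ψ <;>
    rcases op with _ | _ | _ | _ | _ | op <;>
    simp [merge, exprCode, mergeCode, BoundedFormula.mapTermRel, Term.relabel, symbols_falsum,
      symbols_equal, symbols_le, symbols_imp, termSymbols_func₂] <;>
    rfl

/-- The operation on codes corresponding to `node`. -/
def nodeCode (op i j : ℕ) (A B : ℕ × Bool × List ℕ) : ℕ × Bool × List ℕ :=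
  if op = 0 then (i, false, [0]) else
  if op = 1 then (i + j + 1, false, [2 * (2 * j + 1)]) else
  if op = 2 then (i, false, [2 * Nat.pair 0 0 + 1]) else
  if op = 3 then (i, false, [2 * Nat.pair 0 1 + 1]) else
  if op = 4 then (i, true, [logicSymbol (i + 2)]) else
  if op = 5 then
    if A.2.1 = true ∧ A.1 ≠ 0 then (A.1 - 1, true, logicSymbol 1 :: A.2.2) else
    (0, true, [logicSymbol 2])
  else if B.1 = A.1 then (A.1, mergeCode (op - 6) A.1 A.2 B.2) else (0, true, [logicSymbol 2])

theorem code_node (op i j : ℕ) (A B : Σ n, Expr n) :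
    code (node op i j A B) = nodeCode op i j (code A) (code B) := by
  match op with
  | 0 => rfl
  | 1 => rfl
  | 2 => rfl
  | 3 => rfl
  | 4 => rfl
  | 5 =>
    rcases A with ⟨_ | n, t | φ⟩ <;>
      simp [node, code, exprCode, nodeCode, BoundedFormula.mapTermRel, symbols_falsum, symbols_all]
  | op + 6 =>
    obtain ⟨n, e₁⟩ := A
    obtain ⟨m, e₂⟩ := B
    by_cases h : m = n
    · subst h
      rw [show node (op + 6) i j ⟨m, e₁⟩ ⟨m, e₂⟩ = ⟨m, merge op e₁ e₂⟩ from dif_pos rfl]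
      simp [code, nodeCode, exprCode_merge]
    · rw [show node (op + 6) i j ⟨n, e₁⟩ ⟨m, e₂⟩ = ⟨0, .inr .falsum⟩ from dif_neg h]
      simp [code, nodeCode, h, exprCode, BoundedFormula.mapTermRel, symbols_falsum]

/-! ### Primitive recursiveness -/

theorem primrec_logicSymbol : Primrec logicSymbol :=
  Primrec.nat_double_succ.comp Primrec.nat_double_succ

theorem primrec_termSymbol : Primrec₂ termSymbol :=
  Primrec.nat_double.comp (Primrec₂.natPair.comp Primrec.fst (Primrec.encode.comp Primrec.snd))

open Primrec in
theorem primrec_mergeCode : Primrec fun p : (ℕ × ℕ) × (Bool × List ℕ) × (Bool × List ℕ) =>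
    mergeCode p.1.1 p.1.2 p.2.1 p.2.2 := by
  have op : Primrec fun p : (ℕ × ℕ) × (Bool × List ℕ) × (Bool × List ℕ) => p.1.1 :=
    fst.comp fst
  have n : Primrec fun p : (ℕ × ℕ) × (Bool × List ℕ) × (Bool × List ℕ) => p.1.2 :=
    snd.comp fst
  have a1 : Primrec fun p : (ℕ × ℕ) × (Bool × List ℕ) × (Bool × List ℕ) => p.2.1.1 :=
    fst.comp (fst.comp snd)
  have a2 : Primrec fun p : (ℕ × ℕ) × (Bool × List ℕ) × (Bool × List ℕ) => p.2.1.2 :=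
    snd.comp (fst.comp snd)
  have b1 : Primrec fun p : (ℕ × ℕ) × (Bool × List ℕ) × (Bool × List ℕ) => p.2.2.1 :=
    fst.comp (snd.comp snd)
  have b2 : Primrec fun p : (ℕ × ℕ) × (Bool × List ℕ) × (Bool × List ℕ) => p.2.2.2 :=
    snd.comp (snd.comp snd)
  have cond (c : Bool) (k : ℕ) := (Primrec.eq.comp a1 (const c)).and
    ((Primrec.eq.comp b1 (const c)).and (Primrec.eq.comp op (const k)))
  have ab := list_append.comp a2 b2
  have sa := primrec_termSymbol.comp n a2
  have sb := primrec_termSymbol.comp n b2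
  have two := list_cons.comp sa (list_cons.comp sb (const []))
  exact ite (cond false 0) ((const false).pair (list_cons.comp (const _) ab)) <|
    ite (cond false 1) ((const false).pair (list_cons.comp (const _) ab)) <|
    ite (cond false 2) ((const true).pair two) <|
    ite (cond false 3) ((const true).pair (list_cons.comp (const _)
      (list_cons.comp (primrec_logicSymbol.comp n) two))) <|
    ite (cond true 4) ((const true).pair (list_cons.comp (const _) ab)) <|
    (const true).pair (list_cons.comp (primrec_logicSymbol.comp (nat_add.comp n (const 2)))
      (const []))

open Primrec in
theorem primrec_nodeCode :
    Primrec fun p : (ℕ × ℕ × ℕ) × (ℕ × Bool × List ℕ) × (ℕ × Bool × List ℕ) =>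
      nodeCode p.1.1 p.1.2.1 p.1.2.2 p.2.1 p.2.2 := by
  have op : Primrec fun p : (ℕ × ℕ × ℕ) × (ℕ × Bool × List ℕ) × (ℕ × Bool × List ℕ) => p.1.1 :=
    fst.comp fst
  have i : Primrec fun p : (ℕ × ℕ × ℕ) × (ℕ × Bool × List ℕ) × (ℕ × Bool × List ℕ) => p.1.2.1 :=
    fst.comp (snd.comp fst)
  have j : Primrec fun p : (ℕ × ℕ × ℕ) × (ℕ × Bool × List ℕ) × (ℕ × Bool × List ℕ) => p.1.2.2 :=
    snd.comp (snd.comp fst)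
  have A : Primrec fun p : (ℕ × ℕ × ℕ) × (ℕ × Bool × List ℕ) × (ℕ × Bool × List ℕ) => p.2.1 :=
    fst.comp snd
  have B : Primrec fun p : (ℕ × ℕ × ℕ) × (ℕ × Bool × List ℕ) × (ℕ × Bool × List ℕ) => p.2.2 :=
    snd.comp snd
  have A1 := fst.comp A
  have A2 := snd.comp A
  have cond (k : ℕ) := Primrec.eq.comp op (const k)
  have bot := const (α := (ℕ × ℕ × ℕ) × (ℕ × Bool × List ℕ) × (ℕ × Bool × List ℕ))
    ((0, true, [logicSymbol 2]) : ℕ × Bool × List ℕ)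
  exact ite (cond 0) (i.pair (const _)) <|
    ite (cond 1) ((succ.comp (nat_add.comp i j)).pair ((const false).pair
      (list_cons.comp (nat_double.comp (nat_double_succ.comp j)) (const [])))) <|
    ite (cond 2) (i.pair (const _)) <|
    ite (cond 3) (i.pair (const _)) <|
    ite (cond 4) (i.pair ((const true).pair (list_cons.comp
      (primrec_logicSymbol.comp (nat_add.comp i (const 2))) (const [])))) <|
    ite (cond 5) (ite ((Primrec.eq.comp (fst.comp A2) (const true)).and
        (Primrec.eq.comp A1 (const 0)).not)
      ((pred.comp A1).pair ((const true).pair (list_cons.comp (const _) (snd.comp A2)))) bot) <|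
    ite (Primrec.eq.comp (fst.comp B) A1)
      (A1.pair (primrec_mergeCode.comp
        (((nat_sub.comp op (const 6)).pair A1).pair (A2.pair (snd.comp B))))) bot

/-- One step of the course-of-values recursion for the codes of `enum`. -/
def codeStep (l : List (ℕ × Bool × List ℕ)) : ℕ × Bool × List ℕ :=
  if l.length = 0 then (0, true, [logicSymbol 2]) else
    nodeCode (l.length - 1).unpair.1 (l.length - 1).unpair.2.unpair.1
      (l.length - 1).unpair.2.unpair.2
      ((l[(l.length - 1).unpair.2.unpair.1]?).getD (0, true, []))
      ((l[(l.length - 1).unpair.2.unpair.2]?).getD (0, true, []))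

open Primrec in
theorem primrec_codeStep : Primrec codeStep := by
  have m : Primrec fun l : List (ℕ × Bool × List ℕ) => (l.length - 1).unpair :=
    unpair.comp (pred.comp list_length)
  have ij := unpair.comp (snd.comp m)
  have get {f : List (ℕ × Bool × List ℕ) → ℕ} (hf : Primrec f) :=
    option_getD.comp (list_getElem?.comp Primrec.id hf) (const ((0, true, []) : ℕ × Bool × List ℕ))
  exact ite (Primrec.eq.comp list_length (const 0)) (const _)
    (primrec_nodeCode.comp (((fst.comp m).pair ij).pair
      ((get (fst.comp ij)).pair (get (snd.comp ij)))))

theorem codeStep_eq (n : ℕ) :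
    codeStep ((List.range n).map fun m => code (enum m)) = code (enum n) := by
  rcases n with _ | m
  · rw [enum]; rfl
  · have h₁ : m.unpair.2.unpair.1 < m + 1 :=
      Nat.lt_succ_of_le ((Nat.unpair_left_le _).trans (Nat.unpair_right_le _))
    have h₂ : m.unpair.2.unpair.2 < m + 1 :=
      Nat.lt_succ_of_le ((Nat.unpair_right_le _).trans (Nat.unpair_right_le _))
    rw [enum, code_node]
    simp [codeStep, h₁, h₂]

theorem primrec_code_enum : Primrec fun n => code (enum n) := by
  have h : Primrec₂ fun (_ : Unit) n => code (enum n) :=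
    Primrec.nat_strong_rec _ (g := fun _ l => some (codeStep l))
      (Primrec.option_some.comp (primrec_codeStep.comp Primrec.snd)) fun _ n => by
        rw [codeStep_eq]
  exact h.comp (Primrec.const ()) Primrec.id

/-! ### The type of an undefinable element -/

/-- The formula with one free and one bound variable numbered by `m`. -/
def unaryFormula (m : ℕ) : Larith.BoundedFormula (Fin 1) 1 :=
  match enum m with
  | ⟨1, .inr φ⟩ => φ
  | _ => .falsum

theorem exists_unaryFormula (φ : Larith.BoundedFormula (Fin 1) 1) : ∃ m, unaryFormula m = φ := by
  obtain ⟨m, hm⟩ := exists_enum_formula φ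
  exact ⟨m, by simp [unaryFormula, hm]⟩

theorem symbols_unaryFormula (m : ℕ) : symbols (liftFormula (unaryFormula m)) =
    if (code (enum m)).1 = 1 ∧ (code (enum m)).2.1 = true then (code (enum m)).2.2
      else [logicSymbol 3] := by
  rw [unaryFormula]
  rcases enum m with ⟨_ | _ | n, t | φ⟩ <;>
    simp [code, exprCode, BoundedFormula.mapTermRel, symbols_falsum]

theorem primrec_symbols_unaryFormula :
    Primrec fun m => symbols (liftFormula (unaryFormula m)) := by
  have h := primrec_code_enum
  refine (Primrec.ite ((Primrec.eq.comp (Primrec.fst.comp h) (Primrec.const 1)).and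
    (Primrec.eq.comp (Primrec.fst.comp (Primrec.snd.comp h)) (Primrec.const true)))
    (Primrec.snd.comp (Primrec.snd.comp h)) (Primrec.const [logicSymbol 3])).of_eq fun m => ?_
  rw [symbols_unaryFormula]

/-- The formula saying that the last variable is not the only solution of `χ`. -/
def notUnique (χ : Larith.BoundedFormula (Fin 1) 1) : Larith.BoundedFormula (Fin 3) 0 :=
  (BoundedFormula.all ((liftFormula χ).imp
    (.equal (.var (.inr 0)) (.var (.inl (Fin.last 2)))))).imp
    (BoundedFormula.all ((liftFormula χ).imp .falsum))

/-- Adds a trivially true hypothesis to a formula. -/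
def pad (φ : Larith.BoundedFormula (Fin 3) 0) : Larith.BoundedFormula (Fin 3) 0 :=
  (BoundedFormula.falsum.imp BoundedFormula.falsum).imp φ

/-- The formula saying that the last variable is not the only solution of the formula numbered
by `m`, padded to have code at least `m`. -/
def avoid (m : ℕ) : Larith.Formula (Fin 3) :=
  pad^[m] (notUnique (unaryFormula m))

theorem symbols_notUnique (χ : Larith.BoundedFormula (Fin 1) 1) : symbols (notUnique χ) =
    [logicSymbol 0, logicSymbol 1, logicSymbol 0] ++ (symbols (liftFormula χ) ++
      (symbols (.equal (.var (.inr 0)) (.var (.inl (Fin.last 2))) :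
          Larith.BoundedFormula (Fin 3) 1) ++ [logicSymbol 1, logicSymbol 0] ++
        (symbols (liftFormula χ) ++ [logicSymbol 3]))) := by
  simp [notUnique, symbols_imp, symbols_all, symbols_falsum]

theorem symbols_pad_iterate (m : ℕ) (φ : Larith.BoundedFormula (Fin 3) 0) :
    symbols (pad^[m] φ) =
      (fun l => [logicSymbol 0, logicSymbol 0, logicSymbol 2, logicSymbol 2] ++ l)^[m]
        (symbols φ) := by
  induction m with
  | zero => rfl
  | succ m ih =>
    rw [Function.iterate_succ_apply', Function.iterate_succ_apply', ← ih, pad]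
    simp [symbols_imp, symbols_falsum]

theorem le_formulaCode_avoid (m : ℕ) : m ≤ formulaCode (avoid m) := by
  rw [formulaCode_eq]
  refine le_trans ?_ (Encodable.length_le_encode _)
  rw [avoid]
  generalize notUnique (unaryFormula m) = φ
  induction m with
  | zero => exact Nat.zero_le _
  | succ m ih =>
    rw [Function.iterate_succ_apply', pad, symbols_imp]
    simp only [List.length_cons, List.length_append]
    omega

theorem primrec_formulaCode_avoid : Primrec fun m => formulaCode (avoid m) := by
  have h := primrec_symbols_unaryFormula
  have happ {f g : ℕ → List ℕ} (hf : Primrec f) (hg : Primrec g) : Primrec fun m => f m ++ g m :=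
    Primrec.list_append.comp hf hg
  have hu : Primrec fun m => symbols (notUnique (unaryFormula m)) := by
    simp only [symbols_notUnique]
    exact happ (Primrec.const _) (happ h (happ (Primrec.const _) (happ h (Primrec.const _))))
  have hp : Primrec fun m => symbols (avoid m) := by
    simp only [avoid, symbols_pad_iterate]
    exact Primrec.nat_iterate Primrec.id hu
      (Primrec.list_append.comp (Primrec.const _) Primrec.snd)
  exact (Primrec.encode.comp hp).of_eq fun m => (formulaCode_eq _).symm

/-- The type of an element below the second parameter that is not definable from the first. -/
def undefinableType : Set (Larith.Formula (Fin 3)) :=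
  insert (ltFormula 2 1) (Set.range avoid)

theorem isRecursiveSet_undefinableType : IsRecursiveSet undefinableType := by
  have hR : PrimrecRel fun m n : ℕ => formulaCode (avoid m) = n :=
    Primrec.eq.comp (primrec_formulaCode_avoid.comp Primrec.fst) Primrec.snd
  have hE : PrimrecPred fun n : ℕ => ∃ m < n + 1, formulaCode (avoid m) = n :=
    hR.exists_lt.comp Primrec.succ Primrec.id
  have hL : PrimrecPred fun n : ℕ => formulaCode (ltFormula 2 1) = n :=
    Primrec.eq.comp (Primrec.const _) Primrec.id
  refine ((hL.or hE).of_eq fun n => ?_).computablePred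
  simp only [undefinableType, Set.exists_mem_insert, Set.exists_range_iff]
  refine or_congr Iff.rfl ⟨fun ⟨m, _, h⟩ => ⟨m, h⟩, fun ⟨m, h⟩ => ⟨m, ?_, h⟩⟩
  exact Nat.lt_succ_of_le (h ▸ le_formulaCode_avoid m)

section Semantics

variable {M : Type} [Larith.Structure M]

theorem realize_liftFormula {n : ℕ} (χ : Larith.BoundedFormula (Fin 1) n) (v : Fin 3 → M)
    (xs : Fin n → M) : (liftFormula χ).Realize v xs ↔ χ.Realize (fun _ => v 0) xs := by
  refine BoundedFormula.realize_mapTermRel_id (fun n t xs => ?_) fun _ _ _ => rfl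
  rw [Term.realize_relabel]
  congr 1
  ext (i | i) <;> rfl

theorem realize_pad (φ : Larith.BoundedFormula (Fin 3) 0) (v : Fin 3 → M) (xs : Fin 0 → M) :
    (pad φ).Realize v xs ↔ φ.Realize v xs := by
  simp [pad, BoundedFormula.realize_imp]

theorem realize_notUnique (χ : Larith.BoundedFormula (Fin 1) 1) (v : Fin 3 → M) (xs : Fin 0 → M) :
    (notUnique χ).Realize v xs ↔
      ¬∀ y : M, χ.Realize (fun _ => v 0) (fun _ => y) ↔ y = v (Fin.last 2) := by
  have hs (y : M) : (Fin.snoc xs y : Fin 1 → M) = fun _ => y := by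
    ext i
    obtain rfl : i = Fin.last 0 := Subsingleton.elim (α := Fin 1) _ _
    exact Fin.snoc_last ..
  simp only [notUnique, BoundedFormula.realize_imp, BoundedFormula.realize_all,
    realize_liftFormula, hs]
  change ((∀ y, _ → y = v (Fin.last 2)) → ∀ y, _ → False) ↔ _
  constructor
  · intro h h'
    exact h (fun y => (h' y).1) _ ((h' _).2 rfl)
  · intro h h' y hy
    exact h fun z => ⟨h' z, fun hz => hz ▸ h' y hy ▸ hy⟩

theorem realize_avoid (m : ℕ) (v : Fin 3 → M) : (avoid m).Realize v ↔
    ¬∀ y : M, (unaryFormula m).Realize (fun _ => v 0) (fun _ => y) ↔ y = v (Fin.last 2) := by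
  rw [← realize_notUnique _ v default, avoid, Formula.Realize]
  generalize notUnique (unaryFormula m) = φ
  induction m with
  | zero => rfl
  | succ m ih => rw [Function.iterate_succ_apply', realize_pad, ih]

theorem exists_unaryFormula_realize (φ : Larith.Formula (Fin 2)) : ∃ m, ∀ a y : M,
    (unaryFormula m).Realize (fun _ => a) (fun _ => y) ↔ φ.Realize ![a, y] := by
  obtain ⟨m, hm⟩ := exists_unaryFormula (BoundedFormula.relabel
    (![.inl 0, .inr 0] : Fin 2 → Fin 1 ⊕ Fin 1) φ)
  refine ⟨m, fun a y => ?_⟩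
  rw [hm]
  refine BoundedFormula.realize_relabel.trans ?_
  rw [Formula.Realize]
  refine iff_of_eq (congr_arg₂ _ ?_ (Subsingleton.elim _ _))
  ext i
  fin_cases i <;> rfl

/-! ### Standard elements of a model -/

theorem numeral_injective (hM : IsPAModel M) : Function.Injective (numeral M) := by
  intro m
  induction m with
  | zero =>
    rintro (_ | n) h
    · rfl
    · exact (hM.succ_ne_zero _ h.symm).elim
  | succ m ih =>
    rintro (_ | n) h
    · exact (hM.succ_ne_zero _ h).elim
    · rw [ih (hM.succ_inj _ _ h)]

theorem realize_add {α : Type} (s t : Larith.Term α) (v : α → M) :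
    (Term.func addSymb ![s, t]).realize v = addM (s.realize v) (t.realize v) := by
  rw [Term.realize, addM]
  congr 1
  ext i
  fin_cases i <;> rfl

theorem realize_zero {α : Type} (v : α → M) :
    (zeroTerm : Larith.Term α).realize v = zeroM M := by
  rw [Term.realize, zeroM]
  congr 1
  exact Subsingleton.elim _ _

theorem realize_one {α : Type} (v : α → M) :
    (oneTerm : Larith.Term α).realize v = oneM M := by
  rw [Term.realize, oneM]
  congr 1
  exact Subsingleton.elim _ _

theorem zero_addM (hM : IsPAModel M) (x : M) : addM (zeroM M) x = x := by
  have h := hM.induction 0 (Term.equal (.func addSymb ![zeroTerm, .var 0]) (.var 0)) ![]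
  simp only [Formula.realize_equal, realize_add, realize_zero, Term.realize_var] at h
  have hs (x : M) : (Fin.snoc (![] : Fin 0 → M) x : Fin 1 → M) 0 = x := rfl
  simp only [Nat.reduceAdd, hs] at h
  exact h (hM.add_zero' _) (fun x hx => by rw [hM.add_succ, hx]) x

theorem succ_addM (hM : IsPAModel M) (x y : M) :
    addM (addM x (oneM M)) y = addM (addM x y) (oneM M) := by
  have h := hM.induction 1 (Term.equal
    (.func addSymb ![.func addSymb ![.var 0, oneTerm], .var 1])
    (.func addSymb ![.func addSymb ![.var 0, .var 1], oneTerm])) ![x]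
  simp only [Formula.realize_equal, realize_add, realize_one, Term.realize_var] at h
  have hs₀ (y : M) : (Fin.snoc (![x] : Fin 1 → M) y : Fin 2 → M) 0 = x := rfl
  have hs₁ (y : M) : (Fin.snoc (![x] : Fin 1 → M) y : Fin 2 → M) 1 = y := rfl
  simp only [Nat.reduceAdd, hs₀, hs₁] at h
  exact h (by rw [hM.add_zero', hM.add_zero']) (fun y hy => by rw [hM.add_succ, hy, hM.add_succ]) y

theorem eq_zero_or_exists_succ (hM : IsPAModel M) (x : M) :
    x = zeroM M ∨ ∃ y, x = addM y (oneM M) := by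
  have h := hM.induction 0 ((Term.equal (.var 0) zeroTerm) ⊔
    (BoundedFormula.ex (.equal (.var (.inl 0))
      (.func addSymb ![.var (.inr 0), oneTerm])))) ![]
  have hr (x : M) : Formula.Realize ((Term.equal (.var 0) zeroTerm) ⊔
      (BoundedFormula.ex (.equal (.var (.inl 0))
        (.func addSymb ![.var (.inr 0), oneTerm]))))
        (Fin.snoc (![] : Fin 0 → M) x : Fin 1 → M) ↔
      x = zeroM M ∨ ∃ y, x = addM y (oneM M) := by
    refine Formula.realize_sup.trans (or_congr ?_ ?_)
    · rw [Formula.realize_equal, realize_zero]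
      rfl
    · refine BoundedFormula.realize_ex.trans (exists_congr fun y => ?_)
      simp only [BoundedFormula.Realize, realize_add, realize_one]
      rfl
  exact (hr x).1 (h ((hr _).2 (.inl rfl)) (fun x _ => (hr _).2 (.inr ⟨x, rfl⟩)) x)

theorem numeral_leM (hM : IsPAModel M) {c : M} (hc : ∀ n : ℕ, c ≠ numeral M n) (n : ℕ) :
    leM (numeral M n) c := by
  rw [hM.le_iff]
  induction n with
  | zero => exact ⟨c, zero_addM hM c⟩
  | succ n ih =>
    obtain ⟨z, hz⟩ := ih
    rcases eq_zero_or_exists_succ hM z with rfl | ⟨w, rfl⟩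
    · exact (hc n (by rw [← hz, hM.add_zero'])).elim
    · exact ⟨w, by rw [numeral, succ_addM hM, ← hM.add_succ, hz]⟩

theorem realize_ltFormula (v : Fin 3 → M) :
    (ltFormula 2 1).Realize v ↔ leM (v (Fin.last 2)) (v 1) ∧ v (Fin.last 2) ≠ v 1 := by
  refine Formula.realize_inf.trans (and_congr ?_ ?_)
  · exact BoundedFormula.realize_rel₂
  · refine Formula.realize_not.trans (not_congr ?_)
    exact BoundedFormula.realize_bdEqual _ _

theorem finite_not_realize (hM : IsPAModel M) {a c : M} (hc : ∀ n : ℕ, c ≠ numeral M n)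
    {φ : Larith.Formula (Fin 3)} (hφ : φ ∈ undefinableType) :
    {n : ℕ | ¬φ.Realize (Fin.snoc ![a, c] (numeral M n))}.Finite := by
  rcases hφ with rfl | ⟨m, rfl⟩
  · refine Set.finite_empty.subset fun n hn => hn ?_
    exact (realize_ltFormula _).2 ⟨numeral_leM hM hc n, (hc n).symm⟩
  · refine Set.Subsingleton.finite fun n hn k hk => numeral_injective hM ?_
    simp only [Set.mem_ofPred_eq, realize_avoid, not_not, Fin.snoc_last] at hn hk
    exact (hk _).1 ((hn _).2 rfl)

theorem exists_realize_finset (hM : IsPAModel M) {a c : M} (hc : ∀ n : ℕ, c ≠ numeral M n)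
    (T : Finset (Larith.Formula (Fin 3))) (hT : ↑T ⊆ undefinableType) :
    ∃ x : M, ∀ φ ∈ T, φ.Realize (Fin.snoc ![a, c] x) := by
  have hfin : (⋃ φ ∈ T, {n : ℕ | ¬φ.Realize (Fin.snoc ![a, c] (numeral M n))}).Finite :=
    T.finite_toSet.biUnion fun φ hφ => finite_not_realize hM hc (hT hφ)
  obtain ⟨n, hn⟩ := hfin.exists_notMem
  simp only [Set.mem_iUnion, Set.mem_ofPred_eq, not_exists, not_not] at hn
  exact ⟨numeral M n, hn⟩

end Semantics

end ShortRecSatProof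

open ShortRecSatProof

/-- A nonstandard short recursively saturated model of PA is not finitely
generated. -/
theorem short_rec_sat_not_finitely_generated {M : Type} [Larith.Structure M]
    (hM : IsPAModel M) (hns : ∃ x : M, ∀ n : ℕ, x ≠ numeral M n)
    (hsrs : ShortRecSat M) :
    ¬∃ a : M, ∀ x : M, DefinableFrom a x := by
  rintro ⟨a, ha⟩
  obtain ⟨c, hc⟩ := hns
  obtain ⟨x, hx⟩ := hsrs 2 undefinableType isRecursiveSet_undefinableType
    ⟨1, Set.mem_insert _ _⟩ ![a, c] (exists_realize_finset hM hc)
  obtain ⟨φ, hφ⟩ := ha x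
  obtain ⟨m, hm⟩ := exists_unaryFormula_realize (M := M) φ
  refine (realize_avoid m _).1 (hx (avoid m) (Set.mem_insert_of_mem _ ⟨m, rfl⟩)) fun y => ?_
  rw [Fin.snoc_last]
  exact (hm a y).trans (hφ y)
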